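/- Let k ≥ 2 be an integer. The function U : A_k^ℕ → ℝ defined by U(x) = log(1 + v_{x_0}/(λ/(λ−1) + Σ_{l∈A_k} v_l·|x_{[0…δ_{s_k}(x)−1]}|_l − v_{x_0})) when δ_{s_k}(x) < ∞, and U(x) = 0 when x ∈ Σ_{s_k}, is a nonnegative continuous function which is a fixed point of the renormalization operator: RU = U. -/

import Mathlib

/-- The `k`-bonacci substitution on letters: `a ↦ 0(a+1)` if `a ≠ k-1`, and `k-1 ↦ 0`. -/
def sLetter {k : ℕ} (a : Fin k) : List (Fin k) :=
  if h : (a : ℕ) + 1 < k then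
    [⟨0, Nat.lt_of_le_of_lt (Nat.zero_le _) a.isLt⟩, ⟨(a : ℕ) + 1, h⟩]
  else
    [⟨0, Nat.lt_of_le_of_lt (Nat.zero_le _) a.isLt⟩]

/-- Extension of the substitution to finite words by concatenation. -/
def sWord {k : ℕ} (w : List (Fin k)) : List (Fin k) := w.flatMap sLetter

/-- The prefix of length `n` of a right-infinite sequence. -/
def pref {k : ℕ} (x : ℕ → Fin k) (n : ℕ) : List (Fin k) :=
  (List.range n).map x

/-- Extension of the substitution to right-infinite sequences, by concatenating the
images of the letters: since each letter has a nonempty image, the `m`-th letter of the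
image is the `m`-th letter of the image of the prefix of length `m+1`. -/
def sSeq {k : ℕ} (x : ℕ → Fin k) : ℕ → Fin k :=
  fun m => (sWord (pref x (m + 1))).getD m (x 0)

/-- The left shift on sequences. -/
def shift {k : ℕ} (x : ℕ → Fin k) : ℕ → Fin k := fun n => x (n + 1)

/-- The language of the substitution: finite words occurring as a subword of some `s^m(a)`. -/
def Lang {k : ℕ} (w : List (Fin k)) : Prop :=
  ∃ (a : Fin k) (m : ℕ), w <:+: sWord^[m] [a]

/-- `delta x = sup {n : prefix of x of length n is in the language}`, valued in `ℕ∞`. -/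
noncomputable def delta {k : ℕ} (x : ℕ → Fin k) : ℕ∞ :=
  sSup {N : ℕ∞ | ∃ n : ℕ, N = (n : ℕ∞) ∧ Lang (pref x n)}

/-- The subshift associated to the substitution: sequences all of whose subwords
lie in the language. -/
def Attr (k : ℕ) : Set (ℕ → Fin k) :=
  {x | ∀ i n, Lang ((List.range n).map (fun j => x (i + j)))}

/-- The renormalization operator. -/
noncomputable def Renorm {k : ℕ} (V : (ℕ → Fin k) → ℝ) : (ℕ → Fin k) → ℝ :=
  fun x => ∑ j ∈ Finset.range (sLetter (x 0)).length, V (shift^[j] (sSeq x))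

/-- `vcoef k lam l = lam^{-(k-1-l)} * ∑_{j=0}^{k-1-l} lam^j`. -/
noncomputable def vcoef (k : ℕ) (lam : ℝ) (l : ℕ) : ℝ :=
  (∑ j ∈ Finset.range (k - l), lam ^ j) / lam ^ (k - 1 - l)

/-- The fixed point of the renormalization operator. -/
noncomputable def Ufix (k : ℕ) (lam : ℝ) (x : ℕ → Fin k) : ℝ :=
  if delta x = ⊤ then 0
  else Real.log (1 + vcoef k lam (x 0) /
    (lam / (lam - 1)
      + (∑ l : Fin k, vcoef k lam (l : ℕ) * ((pref x (delta x).toNat).count l : ℝ))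
      - vcoef k lam (x 0)))

/-- The word `s^n(0) · s^{n-1}(0) ⋯ s(0) · 0`. -/
def bword {k : ℕ} (z : Fin k) (n : ℕ) : List (Fin k) :=
  ((List.range (n + 1)).map (fun i => sWord^[n - i] [z])).flatten

/-- The word `s^{n-1}(0) · s^{n-2}(0) ⋯ s(0) · 0`. -/
def bsuffix {k : ℕ} (z : Fin k) (n : ℕ) : List (Fin k) :=
  ((List.range n).map (fun i => sWord^[n - 1 - i] [z])).flatten

open Filter Topology

section Words

variable {k : ℕ}

lemma sLetter_of_lt [NeZero k] {a : Fin k} (h : (a : ℕ) + 1 < k) :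
    sLetter a = [0, ⟨(a : ℕ) + 1, h⟩] := by
  simp only [sLetter, h, dif_pos]
  rfl

lemma sLetter_of_not_lt [NeZero k] {a : Fin k} (h : ¬ (a : ℕ) + 1 < k) : sLetter a = [0] := by
  simp only [sLetter, h, dif_neg, not_false_eq_true]
  rfl

lemma mk_succ_ne_zero [NeZero k] {n : ℕ} (h : n + 1 < k) : (⟨n + 1, h⟩ : Fin k) ≠ 0 := by
  intro e
  simpa using congrArg Fin.val e

lemma exists_sLetter_eq_cons [NeZero k] (a : Fin k) : ∃ t, sLetter a = 0 :: t := by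
  by_cases h : (a : ℕ) + 1 < k
  · exact ⟨_, sLetter_of_lt h⟩
  · exact ⟨_, sLetter_of_not_lt h⟩

@[simp] lemma sWord_nil : sWord ([] : List (Fin k)) = [] := rfl

@[simp] lemma sWord_cons (a : Fin k) (w : List (Fin k)) :
    sWord (a :: w) = sLetter a ++ sWord w := by simp [sWord]

@[simp] lemma sWord_append (u w : List (Fin k)) : sWord (u ++ w) = sWord u ++ sWord w := by
  simp [sWord]

lemma iterate_sWord_append (m : ℕ) (u w : List (Fin k)) :
    sWord^[m] (u ++ w) = sWord^[m] u ++ sWord^[m] w := by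
  induction m generalizing u w with
  | zero => rfl
  | succ m ih => simp [ih]

lemma exists_sWord_eq_cons [NeZero k] {w : List (Fin k)} (hw : w ≠ []) :
    ∃ t, sWord w = 0 :: t := by
  obtain ⟨a, u, rfl⟩ := List.exists_cons_of_ne_nil hw
  obtain ⟨t, ht⟩ := exists_sLetter_eq_cons a
  exact ⟨t ++ sWord u, by simp [ht]⟩

lemma iterate_sWord_ne_nil [NeZero k] (m : ℕ) {w : List (Fin k)} (hw : w ≠ []) :
    sWord^[m] w ≠ [] := by
  induction m generalizing w with
  | zero => exact hw
  | succ m ih =>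
    obtain ⟨t, ht⟩ := exists_sWord_eq_cons hw
    exact ih (by simp [ht])

lemma length_le_length_sWord [NeZero k] (w : List (Fin k)) : w.length ≤ (sWord w).length := by
  induction w with
  | nil => simp
  | cons a w ih =>
    obtain ⟨t, ht⟩ := exists_sLetter_eq_cons a
    simp [ht]
    omega

lemma List.IsInfix.map_sWord {u w : List (Fin k)} (h : u <:+: w) :
    sWord u <:+: sWord w := by
  obtain ⟨p, q, rfl⟩ := h
  exact ⟨sWord p, sWord q, by simp⟩

/-- The shortest word starting with `sLetter b` which is enough to recognize `b`. -/
def recWord [NeZero k] (b : Fin k) : List (Fin k) :=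
  if h : (b : ℕ) + 1 < k then [0, ⟨(b : ℕ) + 1, h⟩] else [0, 0]

lemma recWord_of_lt [NeZero k] {b : Fin k} (h : (b : ℕ) + 1 < k) :
    recWord b = [0, ⟨(b : ℕ) + 1, h⟩] := dif_pos h

lemma recWord_of_not_lt [NeZero k] {b : Fin k} (h : ¬ (b : ℕ) + 1 < k) :
    recWord b = [0, 0] := dif_neg h

@[simp] lemma length_recWord [NeZero k] (b : Fin k) : (recWord b).length = 2 := by
  unfold recWord; split <;> rfl

lemma exists_recWord_eq_cons [NeZero k] (b : Fin k) : ∃ t, recWord b = 0 :: t := by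
  unfold recWord; split <;> exact ⟨_, rfl⟩

lemma exists_sWord_append_recWord_eq_cons [NeZero k] (w : List (Fin k)) (b : Fin k) :
    ∃ t, sWord w ++ recWord b = 0 :: t := by
  rcases eq_or_ne w [] with rfl | hw
  · exact exists_recWord_eq_cons b
  · obtain ⟨t, ht⟩ := exists_sWord_eq_cons hw
    exact ⟨t ++ recWord b, by simp [ht]⟩

lemma sWord_eq_nil_or_cons [NeZero k] (u : List (Fin k)) : sWord u = [] ∨ ∃ t, sWord u = 0 :: t := by
  rcases eq_or_ne u [] with rfl | hu
  · exact Or.inl rfl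
  · exact Or.inr (exists_sWord_eq_cons hu)

lemma eq_of_sLetter_append_prefix [NeZero k] {a c : Fin k} {r u : List (Fin k)}
    (hr : ¬ (a : ℕ) + 1 < k → ∃ t, r = 0 :: t)
    (h : sLetter a ++ r <+: sLetter c ++ sWord u) : a = c ∧ r <+: sWord u := by
  by_cases ha : (a : ℕ) + 1 < k <;> by_cases hc : (c : ℕ) + 1 < k
  · rw [sLetter_of_lt ha, sLetter_of_lt hc] at h
    simp only [List.cons_append, List.nil_append, List.cons_prefix_cons, Fin.mk.injEq] at h
    exact ⟨Fin.ext (by omega), h.2.2⟩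
  · rw [sLetter_of_lt ha, sLetter_of_not_lt hc] at h
    simp only [List.cons_append, List.nil_append, List.cons_prefix_cons, true_and] at h
    rcases sWord_eq_nil_or_cons u with hu | ⟨t, hu⟩ <;> rw [hu] at h
    · simp at h
    · exact absurd (List.cons_prefix_cons.1 h).1 (mk_succ_ne_zero ha)
  · obtain ⟨t, rfl⟩ := hr ha
    rw [sLetter_of_not_lt ha, sLetter_of_lt hc] at h
    simp only [List.cons_append, List.nil_append, List.cons_prefix_cons, true_and] at h
    exact absurd h.1.symm (mk_succ_ne_zero hc)
  · rw [sLetter_of_not_lt ha, sLetter_of_not_lt hc] at h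
    simp only [List.cons_append, List.nil_append, List.cons_prefix_cons, true_and] at h
    exact ⟨Fin.ext (by omega), h⟩

lemma exists_recWord_eq_sLetter_append [NeZero k] (b : Fin k) :
    ∃ r, recWord b = sLetter b ++ r ∧ (¬ (b : ℕ) + 1 < k → ∃ t, r = 0 :: t) := by
  by_cases hb : (b : ℕ) + 1 < k
  · exact ⟨[], by simp [recWord_of_lt hb, sLetter_of_lt hb], fun h => absurd hb h⟩
  · exact ⟨[0], by simp [recWord_of_not_lt hb, sLetter_of_not_lt hb], fun _ => ⟨[], rfl⟩⟩

lemma prefix_of_sWord_append_recWord_prefix [NeZero k] {w u : List (Fin k)} {b : Fin k}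
    (h : sWord w ++ recWord b <+: sWord u) : w ++ [b] <+: u := by
  induction w generalizing u with
  | nil =>
    cases u with
    | nil => simpa using h.length_le
    | cons c u =>
      obtain ⟨r, hr, hr'⟩ := exists_recWord_eq_sLetter_append b
      rw [sWord_nil, List.nil_append, hr, sWord_cons] at h
      obtain ⟨rfl, -⟩ := eq_of_sLetter_append_prefix hr' h
      simp
  | cons a w ih =>
    cases u with
    | nil => simpa using h.length_le
    | cons c u =>
      rw [sWord_cons, sWord_cons, List.append_assoc] at h
      obtain ⟨rfl, h'⟩ := eq_of_sLetter_append_prefix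
        (fun _ => exists_sWord_append_recWord_eq_cons w b) h
      simpa using ih h'

lemma infix_of_sWord_append_recWord_infix [NeZero k] {w u : List (Fin k)} {b : Fin k}
    (h : sWord w ++ recWord b <:+: sWord u) : w ++ [b] <:+: u := by
  induction u with
  | nil => simpa using h.length_le
  | cons c u ih =>
    by_cases hp : sWord w ++ recWord b <+: sWord (c :: u)
    · exact (prefix_of_sWord_append_recWord_prefix hp).isInfix
    · refine List.infix_cons (ih ?_)
      by_cases hc : (c : ℕ) + 1 < k
      · rw [sWord_cons, sLetter_of_lt hc] at h hp
        simp only [List.cons_append, List.nil_append] at h hp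
        rcases List.infix_cons_iff.1 ((List.infix_cons_iff.1 h).resolve_left hp) with h' | h'
        · obtain ⟨t, ht⟩ := exists_sWord_append_recWord_eq_cons w b
          rw [ht] at h'
          exact absurd (List.cons_prefix_cons.1 h').1.symm (mk_succ_ne_zero hc)
        · exact h'
      · rw [sWord_cons, sLetter_of_not_lt hc] at h hp
        exact (List.infix_cons_iff.1 h).resolve_left hp

lemma zero_cons_infix_sWord [NeZero k] {d : Fin k} (hd : d ≠ 0) {t u : List (Fin k)}
    (h : d :: t <:+: sWord u) : 0 :: d :: t <:+: sWord u := by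
  induction u with
  | nil => simpa using h.length_le
  | cons c u ih =>
    by_cases hc : (c : ℕ) + 1 < k
    · rw [sWord_cons, sLetter_of_lt hc] at h ⊢
      simp only [List.cons_append, List.nil_append] at h ⊢
      rcases List.infix_cons_iff.1 h with h | h
      · exact absurd (List.cons_prefix_cons.1 h).1 hd
      rcases List.infix_cons_iff.1 h with h | h
      · exact (List.cons_prefix_cons.2 ⟨rfl, h⟩).isInfix
      · exact List.infix_cons (List.infix_cons (ih h))
    · rw [sWord_cons, sLetter_of_not_lt hc] at h ⊢
      simp only [List.cons_append, List.nil_append] at h ⊢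
      rcases List.infix_cons_iff.1 h with h | h
      · exact absurd (List.cons_prefix_cons.1 h).1 hd
      · exact List.infix_cons (ih h)

end Words

section Language

variable {k : ℕ}

lemma Lang.of_infix {u w : List (Fin k)} (hw : Lang w) (h : u <:+: w) : Lang u := by
  obtain ⟨a, m, hm⟩ := hw
  exact ⟨a, m, h.trans hm⟩

lemma Lang.map_sWord {w : List (Fin k)} (hw : Lang w) : Lang (sWord w) := by
  obtain ⟨a, m, hm⟩ := hw
  exact ⟨a, m + 1, by simpa only [Function.iterate_succ_apply'] using hm.map_sWord⟩

lemma lang_singleton (a : Fin k) : Lang [a] := ⟨a, 0, List.infix_rfl⟩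

lemma exists_lang_pair [NeZero k] (hk : 2 ≤ k) (n : ℕ) (hn : n < k) :
    ∃ c : Fin k, Lang [⟨n, hn⟩, c] := by
  induction n with
  | zero =>
    refine ⟨⟨1, hk⟩, ?_⟩
    have := (lang_singleton (⟨0, hn⟩ : Fin k)).map_sWord
    rw [sWord_cons, sLetter_of_lt (Nat.lt_of_succ_le (by simpa using hk))] at this
    exact this
  | succ n ih =>
    obtain ⟨c, hc⟩ := ih (by omega)
    refine ⟨0, hc.map_sWord.of_infix ?_⟩
    obtain ⟨t, ht⟩ := exists_sLetter_eq_cons c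
    rw [sWord_cons, sLetter_of_lt (by simpa using hn), sWord_cons, ht]
    exact ⟨[0], t, by simp⟩

lemma Lang.sWord_append_zero [NeZero k] (hk : 2 ≤ k) {w : List (Fin k)} (hw : Lang w) :
    Lang (sWord w ++ [0]) := by
  obtain ⟨a, m, p, q, hm⟩ := hw
  obtain ⟨c, d, j, hj⟩ := exists_lang_pair hk a a.isLt
  have hpair : Lang (sWord^[m] [a, c]) := by
    clear hm
    have h : Lang [a, c] := ⟨d, j, hj⟩
    induction m with
    | zero => exact h
    | succ m ih => rw [Function.iterate_succ_apply']; exact ih.map_sWord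
  have hc : sWord^[m] [c] ≠ [] := iterate_sWord_ne_nil m (by simp)
  rw [show [a, c] = [a] ++ [c] from rfl, iterate_sWord_append, ← hm] at hpair
  have hr : q ++ sWord^[m] [c] ≠ [] := by simp [hc]
  obtain ⟨t, ht⟩ := exists_sWord_eq_cons hr
  refine hpair.map_sWord.of_infix ⟨sWord p, t, ?_⟩
  rw [show p ++ w ++ q ++ sWord^[m] [c] = p ++ w ++ (q ++ sWord^[m] [c]) by simp,
    sWord_append, sWord_append, ht]
  simp

lemma lang_of_lang_sWord_append_recWord [NeZero k] {w : List (Fin k)} {b : Fin k}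
    (h : Lang (sWord w ++ recWord b)) : Lang (w ++ [b]) := by
  obtain ⟨a, m, hm⟩ := h
  cases m with
  | zero =>
    have := hm.length_le
    simp at this
  | succ m =>
    rw [Function.iterate_succ_apply'] at hm
    exact ⟨a, m, infix_of_sWord_append_recWord_infix hm⟩

lemma Lang.zero_cons [NeZero k] {d : Fin k} (hd : d ≠ 0) {t : List (Fin k)}
    (h : Lang (d :: t)) : Lang (0 :: d :: t) := by
  obtain ⟨a, m, hm⟩ := h
  cases m with
  | zero =>
    have ht : t = [] := by
      have := hm.length_le
      simpa using this
    subst ht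
    have hd0 : (d : ℕ) ≠ 0 := fun e => hd (Fin.ext (by simpa using e))
    have hlt : (d : ℕ) - 1 + 1 < k := by omega
    have := (lang_singleton (⟨(d : ℕ) - 1, by omega⟩ : Fin k)).map_sWord
    rw [sWord_cons, sLetter_of_lt hlt] at this
    have hd : (⟨(d : ℕ) - 1 + 1, hlt⟩ : Fin k) = d :=
      Fin.ext (Nat.sub_add_cancel (Nat.pos_of_ne_zero hd0))
    simpa [hd] using this
  | succ m =>
    rw [Function.iterate_succ_apply'] at hm
    exact ⟨a, m + 1, by rw [Function.iterate_succ_apply']; exact zero_cons_infix_sWord hd hm⟩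

end Language

section Prefixes

variable {k : ℕ}

@[simp] lemma length_pref (x : ℕ → Fin k) (n : ℕ) : (pref x n).length = n := by simp [pref]

lemma pref_succ (x : ℕ → Fin k) (n : ℕ) : pref x (n + 1) = pref x n ++ [x n] := by
  simp [pref, List.range_succ]

lemma pref_succ_eq_cons (x : ℕ → Fin k) (n : ℕ) : pref x (n + 1) = x 0 :: pref (shift x) n := by
  simp only [pref, List.range_succ_eq_map, List.map_cons, List.map_map]
  rfl

lemma pref_prefix_pref (x : ℕ → Fin k) {m n : ℕ} (h : m ≤ n) : pref x m <+: pref x n := by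
  induction n, h using Nat.le_induction with
  | base => exact List.prefix_rfl
  | succ n _ ih => exact ih.trans (by rw [pref_succ]; exact List.prefix_append _ _)

lemma Lang.pref_mono {x : ℕ → Fin k} {m n : ℕ} (hn : Lang (pref x n)) (h : m ≤ n) :
    Lang (pref x m) := hn.of_infix (pref_prefix_pref x h).isInfix

lemma sWord_pref_prefix (x : ℕ → Fin k) {m n : ℕ} (h : m ≤ n) :
    sWord (pref x m) <+: sWord (pref x n) := by
  obtain ⟨t, ht⟩ := pref_prefix_pref x h
  rw [← ht, sWord_append]
  exact List.prefix_append _ _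

lemma sSeq_eq_getElem [NeZero k] (x : ℕ → Fin k) {m n : ℕ} (h : m < (sWord (pref x n)).length) :
    sSeq x m = (sWord (pref x n))[m] := by
  have hm : m < (sWord (pref x (m + 1))).length := by
    have := length_le_length_sWord (pref x (m + 1))
    simp at this
    omega
  rw [sSeq, List.getD_eq_getElem _ _ hm]
  rcases le_total (m + 1) n with h' | h'
  · exact (sWord_pref_prefix x h').getElem hm
  · exact ((sWord_pref_prefix x h').getElem h).symm

lemma pref_sSeq_of_prefix [NeZero k] {x : ℕ → Fin k} {n : ℕ} {p : List (Fin k)}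
    (hp : p <+: sWord (pref x n)) : pref (sSeq x) p.length = p := by
  refine List.ext_getElem (by simp) fun i h₁ h₂ => ?_
  rw [hp.getElem h₂, ← sSeq_eq_getElem]
  simp [pref]

lemma pref_sSeq_sWord_zero [NeZero k] (x : ℕ → Fin k) (n : ℕ) :
    pref (sSeq x) ((sWord (pref x n)).length + 1) = sWord (pref x n) ++ [0] := by
  have hp : sWord (pref x n) ++ [0] <+: sWord (pref x (n + 1)) := by
    obtain ⟨t, ht⟩ := exists_sLetter_eq_cons (x n)
    rw [pref_succ, sWord_append, sWord_cons, ht]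
    simp
  simpa using pref_sSeq_of_prefix hp

lemma pref_sSeq_sWord_recWord [NeZero k] (x : ℕ → Fin k) (n : ℕ) :
    pref (sSeq x) ((sWord (pref x n)).length + 2) = sWord (pref x n) ++ recWord (x n) := by
  have hp : sWord (pref x n) ++ recWord (x n) <+: sWord (pref x (n + 2)) := by
    rw [pref_succ, pref_succ]
    simp only [sWord_append, sWord_cons, sWord_nil, List.append_nil, List.append_assoc]
    rw [List.prefix_append_right_inj]
    by_cases h : (x n : ℕ) + 1 < k
    · rw [recWord_of_lt h, sLetter_of_lt h]
      exact List.prefix_append _ _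
    · obtain ⟨t, ht⟩ := exists_sLetter_eq_cons (x (n + 1))
      rw [recWord_of_not_lt h, sLetter_of_not_lt h, ht]
      simp
  simpa using pref_sSeq_of_prefix hp

/-- The prefix of length `n` is the longest prefix of `x` in the language. -/
def IsMaxPref (x : ℕ → Fin k) (n : ℕ) : Prop := Lang (pref x n) ∧ ¬ Lang (pref x (n + 1))

lemma IsMaxPref.pos {x : ℕ → Fin k} {n : ℕ} (h : IsMaxPref x n) : 0 < n := by
  rcases Nat.eq_zero_or_pos n with rfl | hn
  · exact absurd (lang_singleton (x 0)) h.2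
  · exact hn

lemma coe_le_delta_iff {x : ℕ → Fin k} {n : ℕ} : (n : ℕ∞) ≤ delta x ↔ Lang (pref x n) := by
  refine ⟨fun h => ?_, fun h => le_sSup ⟨n, rfl, h⟩⟩
  by_contra hn
  cases n with
  | zero => exact hn ((lang_singleton (x 0)).of_infix List.nil_infix)
  | succ n =>
    have : delta x ≤ n := by
      refine sSup_le ?_
      rintro _ ⟨m, rfl, hm⟩
      by_contra hlt
      refine hn (hm.pref_mono ?_)
      rw [Nat.cast_le, not_le] at hlt
      omega
    have := h.trans this
    rw [Nat.cast_le] at this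
    omega

lemma delta_eq_top_iff {x : ℕ → Fin k} : delta x = ⊤ ↔ ∀ n, Lang (pref x n) := by
  simp only [← coe_le_delta_iff]
  refine ⟨fun h n => h ▸ le_top, fun h => ?_⟩
  exact ENat.eq_top_iff_forall_ge.2 h

lemma IsMaxPref.delta_eq {x : ℕ → Fin k} {n : ℕ} (h : IsMaxPref x n) : delta x = n := by
  refine le_antisymm ?_ (coe_le_delta_iff.2 h.1)
  by_contra hlt
  refine h.2 (coe_le_delta_iff.1 ?_)
  push_cast
  exact Order.add_one_le_of_lt (not_le.1 hlt)

lemma exists_isMaxPref {x : ℕ → Fin k} (h : delta x ≠ ⊤) : ∃ n, IsMaxPref x n := by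
  obtain ⟨n, hn⟩ := ENat.ne_top_iff_exists.1 h
  refine ⟨n, coe_le_delta_iff.1 hn.le, fun h' => ?_⟩
  have := coe_le_delta_iff.2 h'
  rw [← hn, Nat.cast_le] at this
  omega

lemma IsMaxPref.map_sSeq [NeZero k] (hk : 2 ≤ k) {x : ℕ → Fin k} {n : ℕ} (h : IsMaxPref x n) :
    IsMaxPref (sSeq x) ((sWord (pref x n)).length + 1) := by
  refine ⟨?_, fun h' => h.2 ?_⟩
  · rw [pref_sSeq_sWord_zero]
    exact h.1.sWord_append_zero hk
  · rw [add_assoc, pref_sSeq_sWord_recWord] at h'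
    rw [pref_succ]
    exact lang_of_lang_sWord_append_recWord h'

lemma delta_sSeq_eq_top [NeZero k] {x : ℕ → Fin k} (h : delta x = ⊤) : delta (sSeq x) = ⊤ := by
  rw [delta_eq_top_iff] at h ⊢
  intro n
  have := (h n).map_sWord
  rw [← pref_sSeq_of_prefix (List.prefix_rfl : sWord (pref x n) <+: _)] at this
  refine this.pref_mono ?_
  simpa using length_le_length_sWord (pref x n)

lemma delta_shift_eq_top {x : ℕ → Fin k} (h : delta x = ⊤) : delta (shift x) = ⊤ := by
  rw [delta_eq_top_iff] at h ⊢
  intro n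
  refine (h (n + 1)).of_infix ?_
  rw [pref_succ_eq_cons]
  exact List.infix_cons List.infix_rfl

lemma IsMaxPref.tail [NeZero k] {x : ℕ → Fin k} {n : ℕ} (h : IsMaxPref x (n + 1))
    (h0 : x 0 = 0) (h1 : x 1 ≠ 0) : IsMaxPref (shift x) n := by
  refine ⟨h.1.of_infix ?_, fun h' => h.2 ?_⟩
  · rw [pref_succ_eq_cons]
    exact List.infix_cons List.infix_rfl
  · rw [pref_succ_eq_cons, h0]
    rw [pref_succ_eq_cons] at h' ⊢
    exact h'.zero_cons h1

lemma sSeq_zero [NeZero k] (x : ℕ → Fin k) : sSeq x 0 = 0 := by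
  obtain ⟨t, ht⟩ := exists_sLetter_eq_cons (x 0)
  simp [sSeq, pref, ht]

lemma sSeq_one [NeZero k] {x : ℕ → Fin k} (h : (x 0 : ℕ) + 1 < k) :
    sSeq x 1 = ⟨(x 0 : ℕ) + 1, h⟩ := by
  simp [sSeq, pref, List.range_succ, sLetter_of_lt h]

lemma eventually_pref_eq (x : ℕ → Fin k) (n : ℕ) : ∀ᶠ y in 𝓝 x, pref y n = pref x n := by
  have h : ∀ᶠ y in 𝓝 x, ∀ i ∈ Finset.range n, y i = x i := by
    refine (Finset.eventually_all _).2 fun i _ => ?_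
    have hi : Continuous fun y : ℕ → Fin k => y i := continuous_apply i
    exact ((isOpen_discrete {x i}).preimage hi).mem_nhds rfl
  filter_upwards [h] with y hy
  exact List.map_congr_left fun i hi => hy i (by simpa using hi)

end Prefixes

section Weights

variable {k : ℕ} {lam : ℝ}

lemma one_le_vcoef (hlam : 0 < lam) {l : ℕ} (hl : l < k) : 1 ≤ vcoef k lam l := by
  obtain ⟨n, rfl⟩ : ∃ n, k = l + n + 1 := ⟨k - l - 1, by omega⟩
  rw [vcoef, show l + n + 1 - l = n + 1 by omega, show l + n + 1 - 1 - l = n by omega,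
    le_div_iff₀ (by positivity), one_mul, Finset.sum_range_succ]
  have : 0 ≤ ∑ j ∈ Finset.range n, lam ^ j := by positivity
  linarith

lemma vcoef_zero (hk : 0 < k) (hlam : 0 < lam)
    (hroot : lam ^ k = ∑ j ∈ Finset.range k, lam ^ j) : vcoef k lam 0 = lam := by
  obtain ⟨n, rfl⟩ : ∃ n, k = n + 1 := ⟨k - 1, by omega⟩
  rw [vcoef, Nat.sub_zero, Nat.sub_zero, ← hroot, Nat.add_sub_cancel, pow_succ, mul_div_cancel_left₀ _ (by positivity)]

lemma vcoef_last {l : ℕ} (hl : l + 1 = k) : vcoef k lam l = 1 := by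
  subst hl
  simp [vcoef]

lemma mul_vcoef (hlam : 0 < lam) {l : ℕ} (hl : l + 1 < k) :
    lam * vcoef k lam l = lam + vcoef k lam (l + 1) := by
  obtain ⟨n, rfl⟩ : ∃ n, k = l + n + 2 := ⟨k - l - 2, by omega⟩
  rw [vcoef, vcoef, show l + n + 2 - l = n + 1 + 1 by omega,
    show l + n + 2 - 1 - l = n + 1 by omega, show l + n + 2 - (l + 1) = n + 1 by omega,
    show l + n + 2 - 1 - (l + 1) = n by omega, Finset.sum_range_succ _ (n + 1)]
  field_simp
  ring

/-- The total weight of a word. -/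
noncomputable def weight (lam : ℝ) (w : List (Fin k)) : ℝ :=
  (w.map fun l => vcoef k lam (l : ℕ)).sum

@[simp] lemma weight_nil : weight lam ([] : List (Fin k)) = 0 := rfl

@[simp] lemma weight_cons (a : Fin k) (w : List (Fin k)) :
    weight lam (a :: w) = vcoef k lam (a : ℕ) + weight lam w := by simp [weight]

@[simp] lemma weight_append (u w : List (Fin k)) :
    weight lam (u ++ w) = weight lam u + weight lam w := by simp [weight]

lemma sum_vcoef_mul_count (w : List (Fin k)) :
    ∑ l : Fin k, vcoef k lam (l : ℕ) * (w.count l : ℝ) = weight lam w := by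
  induction w with
  | nil => simp
  | cons a w ih =>
    simp [List.count_cons, mul_add, Finset.sum_add_distrib, ih, add_comm]

lemma length_le_weight (hlam : 0 < lam) (w : List (Fin k)) : (w.length : ℝ) ≤ weight lam w := by
  induction w with
  | nil => simp
  | cons a w ih =>
    have := one_le_vcoef hlam a.isLt
    push_cast [List.length_cons, weight_cons]
    linarith

lemma weight_sLetter [NeZero k] (hlam : 0 < lam)
    (hroot : lam ^ k = ∑ j ∈ Finset.range k, lam ^ j) (a : Fin k) :
    weight lam (sLetter a) = lam * vcoef k lam (a : ℕ) := by
  by_cases h : (a : ℕ) + 1 < k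
  · simp [sLetter_of_lt h, mul_vcoef hlam h, vcoef_zero (Nat.pos_of_neZero k) hlam hroot]
  · simp [sLetter_of_not_lt h, vcoef_last (show (a : ℕ) + 1 = k by omega),
      vcoef_zero (Nat.pos_of_neZero k) hlam hroot]

lemma weight_sWord [NeZero k] (hlam : 0 < lam)
    (hroot : lam ^ k = ∑ j ∈ Finset.range k, lam ^ j) (w : List (Fin k)) :
    weight lam (sWord w) = lam * weight lam w := by
  induction w with
  | nil => simp
  | cons a w ih => simp [ih, weight_sLetter hlam hroot, mul_add]

end Weights

section Potential

variable {k : ℕ} {lam : ℝ}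

lemma Ufix_of_delta_eq_top {x : ℕ → Fin k} (h : delta x = ⊤) : Ufix k lam x = 0 := by
  simp [Ufix, h]

lemma IsMaxPref.Ufix_eq {x : ℕ → Fin k} {n : ℕ} (h : IsMaxPref x (n + 1)) :
    Ufix k lam x = Real.log (1 + vcoef k lam (x 0) /
      (lam / (lam - 1) + weight lam (pref (shift x) n))) := by
  rw [Ufix, h.delta_eq, if_neg (ENat.natCast_ne_top _), ENat.toNat_natCast, sum_vcoef_mul_count,
    pref_succ_eq_cons, weight_cons]
  congr 4
  ring

lemma denom_pos (hlam : 1 < lam) (w : List (Fin k)) : 0 < lam / (lam - 1) + weight lam w := by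
  have h₁ : 0 < lam / (lam - 1) := div_pos (by linarith) (by linarith)
  have h₂ := length_le_weight (zero_lt_one.trans hlam) w
  have h₃ : (0 : ℝ) ≤ w.length := Nat.cast_nonneg _
  linarith

lemma IsMaxPref.Ufix_eq_log_sub_log (hlam : 1 < lam) {x : ℕ → Fin k} {n : ℕ}
    (h : IsMaxPref x (n + 1)) :
    Ufix k lam x = Real.log (lam / (lam - 1) + weight lam (pref x (n + 1))) -
      Real.log (lam / (lam - 1) + weight lam (pref (shift x) n)) := by
  have h₁ := denom_pos hlam (pref (shift x) n)
  rw [h.Ufix_eq, ← Real.log_div (denom_pos hlam _).ne' h₁.ne', pref_succ_eq_cons, weight_cons]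
  congr 1
  field_simp
  ring

lemma Ufix_nonneg (hlam : 1 < lam) (x : ℕ → Fin k) : 0 ≤ Ufix k lam x := by
  by_cases hx : delta x = ⊤
  · exact (Ufix_of_delta_eq_top hx).ge
  obtain ⟨n, hn⟩ := exists_isMaxPref hx
  obtain ⟨n, rfl⟩ := Nat.exists_eq_succ_of_ne_zero hn.pos.ne'
  rw [hn.Ufix_eq]
  refine Real.log_nonneg (le_add_of_nonneg_right (div_nonneg ?_ (denom_pos hlam _).le))
  exact zero_le_one.trans (one_le_vcoef (zero_lt_one.trans hlam) (x 0).isLt)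

lemma Ufix_le_div (hlam : 1 < lam) {x : ℕ → Fin k} {m : ℕ} (hm : Lang (pref x (m + 1))) :
    Ufix k lam x ≤ vcoef k lam (x 0) / (lam / (lam - 1) + m) := by
  have hv : 0 ≤ vcoef k lam (x 0) :=
    zero_le_one.trans (one_le_vcoef (zero_lt_one.trans hlam) (x 0).isLt)
  have hl : 0 < lam / (lam - 1) := div_pos (by linarith) (by linarith)
  by_cases hx : delta x = ⊤
  · rw [Ufix_of_delta_eq_top hx]
    positivity
  obtain ⟨n, hn⟩ := exists_isMaxPref hx
  obtain ⟨n, rfl⟩ := Nat.exists_eq_succ_of_ne_zero hn.pos.ne'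
  have hmn : m ≤ n := by
    by_contra hlt
    exact hn.2 (hm.pref_mono (by omega))
  have hd := denom_pos hlam (pref (shift x) n)
  have hw : (m : ℝ) ≤ weight lam (pref (shift x) n) := by
    have := length_le_weight (zero_lt_one.trans hlam) (pref (shift x) n)
    rw [length_pref] at this
    exact (Nat.cast_le.2 hmn).trans this
  rw [hn.Ufix_eq]
  calc Real.log (1 + vcoef k lam (x 0) / (lam / (lam - 1) + weight lam (pref (shift x) n)))
      ≤ vcoef k lam (x 0) / (lam / (lam - 1) + weight lam (pref (shift x) n)) := by
        have := Real.log_le_sub_one_of_pos (add_pos_of_pos_of_nonneg one_pos (div_nonneg hv hd.le))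
        linarith
    _ ≤ vcoef k lam (x 0) / (lam / (lam - 1) + m) := by gcongr

lemma continuous_Ufix (hlam : 1 < lam) : Continuous (Ufix k lam) := by
  refine continuous_iff_continuousAt.2 fun x => ?_
  by_cases hx : delta x = ⊤
  · rw [ContinuousAt, Ufix_of_delta_eq_top hx]
    refine tendsto_order.2 ⟨fun a ha => .of_forall fun y => ha.trans_le (Ufix_nonneg hlam y),
      fun a ha => ?_⟩
    have hlim : Tendsto (fun m : ℕ => vcoef k lam (x 0) / (lam / (lam - 1) + m)) atTop (𝓝 0) :=
      tendsto_const_nhds.div_atTop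
        (tendsto_atTop_add_const_left _ _ tendsto_natCast_atTop_atTop)
    obtain ⟨m, hm⟩ := (hlim.eventually (gt_mem_nhds ha)).exists
    filter_upwards [eventually_pref_eq x (m + 1)] with y hy
    have h0 : y 0 = x 0 := by
      rw [pref_succ_eq_cons, pref_succ_eq_cons] at hy
      exact (List.cons_eq_cons.1 hy).1
    refine (Ufix_le_div hlam (m := m) ?_).trans_lt (h0 ▸ hm)
    rw [hy]
    exact delta_eq_top_iff.1 hx _
  · obtain ⟨n, hn⟩ := exists_isMaxPref hx
    obtain ⟨n, rfl⟩ := Nat.exists_eq_succ_of_ne_zero hn.pos.ne'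
    refine ContinuousAt.congr (f := fun _ => Ufix k lam x) continuousAt_const ?_
    filter_upwards [eventually_pref_eq x (n + 1 + 1)] with y hy
    have hy' : pref y (n + 1) = pref x (n + 1) := by
      rw [pref_succ y, pref_succ x] at hy
      exact (List.append_inj' hy rfl).1
    have hyn : IsMaxPref y (n + 1) := ⟨hy' ▸ hn.1, hy ▸ hn.2⟩
    rw [pref_succ_eq_cons, pref_succ_eq_cons] at hy'
    rw [hn.Ufix_eq, hyn.Ufix_eq, (List.cons_eq_cons.1 hy').1, (List.cons_eq_cons.1 hy').2]

lemma Renorm_Ufix (hk : 2 ≤ k) (hlam : 1 < lam)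
    (hroot : lam ^ k = ∑ j ∈ Finset.range k, lam ^ j) :
    Renorm (Ufix k lam) = Ufix k lam := by
  have : NeZero k := ⟨by omega⟩
  have hpos : 0 < lam := zero_lt_one.trans hlam
  have hne : lam - 1 ≠ 0 := by linarith
  funext x
  by_cases hx : delta x = ⊤
  · have hs := delta_sSeq_eq_top hx
    rw [Renorm, Ufix_of_delta_eq_top hx]
    refine Finset.sum_eq_zero fun j hj => Ufix_of_delta_eq_top ?_
    clear hj
    induction j with
    | zero => exact hs
    | succ j ih => rw [Function.iterate_succ_apply']; exact delta_shift_eq_top ih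
  obtain ⟨n, hn⟩ := exists_isMaxPref hx
  obtain ⟨n, rfl⟩ := Nat.exists_eq_succ_of_ne_zero hn.pos.ne'
  have hs := hn.map_sSeq hk
  have hscale : ∀ w : List (Fin k), lam / (lam - 1) + weight lam (sWord w ++ [0]) =
      lam * (lam / (lam - 1) + weight lam w) := fun w => by
    simp only [weight_append, weight_sWord hpos hroot, weight_cons, weight_nil, Fin.val_zero,
      vcoef_zero (Nat.pos_of_neZero k) hpos hroot]
    field_simp
    ring
  have hlog : ∀ w : List (Fin k), Real.log (lam / (lam - 1) + weight lam (sWord w ++ [0])) =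
      Real.log lam + Real.log (lam / (lam - 1) + weight lam w) := fun w => by
    rw [hscale, Real.log_mul hpos.ne' (denom_pos hlam w).ne']
  have hp := pref_sSeq_sWord_zero x (n + 1)
  by_cases h : (x 0 : ℕ) + 1 < k
  · have hlen : (sWord (pref x (n + 1))).length = (sWord (pref (shift x) n)).length + 1 + 1 := by
      simp [pref_succ_eq_cons, sLetter_of_lt h]
    have hs' : IsMaxPref (shift (sSeq x)) ((sWord (pref (shift x) n)).length + 1 + 1) := by
      have h1 : sSeq x 1 ≠ 0 := by rw [sSeq_one h]; exact mk_succ_ne_zero h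
      have := hs.tail (sSeq_zero x) h1
      rwa [Nat.succ_eq_add_one, hlen] at this
    have htail : pref (shift (shift (sSeq x))) ((sWord (pref (shift x) n)).length + 1) =
        sWord (pref (shift x) n) ++ [0] := by
      rw [hlen, pref_succ_eq_cons, pref_succ_eq_cons, pref_succ_eq_cons x, sWord_cons,
        sLetter_of_lt h] at hp
      exact (List.cons_eq_cons.1 (List.cons_eq_cons.1 hp).2).2
    rw [Renorm, sLetter_of_lt h]
    simp only [List.length_cons, List.length_nil, Finset.sum_range_succ, Finset.sum_range_zero,
      Function.iterate_zero, id, Function.iterate_succ, Function.comp_apply, zero_add]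
    rw [hn.Ufix_eq_log_sub_log hlam, hs.Ufix_eq_log_sub_log hlam, hs'.Ufix_eq_log_sub_log hlam,
      hp, htail, hlog, hlog, ← hlen]
    ring
  · have hlen : (sWord (pref x (n + 1))).length = (sWord (pref (shift x) n)).length + 1 := by
      simp [pref_succ_eq_cons, sLetter_of_not_lt h]
    have htail : pref (shift (sSeq x)) ((sWord (pref x (n + 1))).length) =
        sWord (pref (shift x) n) ++ [0] := by
      rw [pref_succ_eq_cons, pref_succ_eq_cons x, sWord_cons, sLetter_of_not_lt h,
        List.cons_append, List.cons_append, List.nil_append] at hp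
      rw [pref_succ_eq_cons x, sWord_cons, sLetter_of_not_lt h]
      exact (List.cons_eq_cons.1 hp).2
    rw [Renorm, sLetter_of_not_lt h]
    simp only [List.length_cons, List.length_nil, Finset.sum_range_succ, Finset.sum_range_zero,
      Function.iterate_zero, id, zero_add]
    rw [hn.Ufix_eq_log_sub_log hlam, hs.Ufix_eq_log_sub_log hlam, hp, htail, hlog, hlog]
    ring

end Potential

theorem stmt7 (k : ℕ) (hk : 2 ≤ k) (lam : ℝ) (hlam : 1 < lam)
    (hroot : lam ^ k = ∑ j ∈ Finset.range k, lam ^ j) :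
    (∀ x, 0 ≤ Ufix k lam x) ∧ Continuous (Ufix k lam)
      ∧ Renorm (Ufix k lam) = Ufix k lam :=
  ⟨Ufix_nonneg hlam, continuous_Ufix hlam, Renorm_Ufix hk hlam hroot⟩
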